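/- arXiv:hep-th/0609004 — 3 statements merged into one kernel-verified Lean document; each statement's English description precedes it below -/
import Mathlib

section
/- Let q ∈ ℝ⁴ be a vector with ‖q‖ = 1 and let ρ be a real number with 1/2 < ρ < 3/2. Then the function k ↦ ⟨k,q⟩ / ( (‖k‖²)^{1+ρ} · ‖k+q‖² ) is Lebesgue integrable on ℝ⁴ and ∫_{ℝ⁴} ⟨k,q⟩ / ( (‖k‖²)^{1+ρ} · ‖k+q‖² ) dk = π² / (ρ(ρ−2)). In particular the Mellin transform F(ρ) of the one-loop massless Yukawa fermion self-energy, normalized by 1/π² and evaluated at q² = 1, equals 1/(ρ(ρ−2)). -/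
open MeasureTheory Real
open scoped RealInnerProductSpace

theorem exists_linearIsometryEquiv_apply_eq {E F : Type*}
    [NormedAddCommGroup E] [InnerProductSpace ℝ E] [FiniteDimensional ℝ E]
    [NormedAddCommGroup F] [InnerProductSpace ℝ F] [FiniteDimensional ℝ F]
    (h : Module.finrank ℝ E = Module.finrank ℝ F) {u : E} {v : F}
    (hu : ‖u‖ = 1) (hv : ‖v‖ = 1) : ∃ φ : E ≃ₗᵢ[ℝ] F, φ u = v := by
  have hpos : 0 < Module.finrank ℝ E :=
    Module.finrank_pos_iff_exists_ne_zero.mpr ⟨u, by rintro rfl; simp at hu⟩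
  let i₀ : Fin (Module.finrank ℝ E) := ⟨0, hpos⟩
  obtain ⟨b, hb⟩ := Orthonormal.exists_orthonormalBasis_extension_of_card_eq
    (𝕜 := ℝ) (ι := Fin (Module.finrank ℝ E)) (by simp) (v := fun _ => u) (s := {i₀})
    ⟨fun _ => hu, fun i j hij => (hij (Subsingleton.elim _ _)).elim⟩
  obtain ⟨c, hc⟩ := Orthonormal.exists_orthonormalBasis_extension_of_card_eq
    (𝕜 := ℝ) (ι := Fin (Module.finrank ℝ E)) (by simp [h]) (v := fun _ => v) (s := {i₀})
    ⟨fun _ => hv, fun i j hij => (hij (Subsingleton.elim _ _)).elim⟩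
  refine ⟨b.equiv c (Equiv.refl _), ?_⟩
  rw [← hb i₀ rfl, OrthonormalBasis.equiv_apply_basis]
  exact hc i₀ rfl

theorem exists_measurePreserving_axial (q : EuclideanSpace ℝ (Fin 4)) (hq : ‖q‖ = 1) :
    ∃ φ : ℝ × EuclideanSpace ℝ (Fin 3) ≃ᵐ EuclideanSpace ℝ (Fin 4), MeasurePreserving φ ∧
      ∀ p, ‖φ p‖ ^ 2 = p.1 ^ 2 + ‖p.2‖ ^ 2 ∧ ⟪φ p, q⟫ = p.1 := by
  let u : WithLp 2 (ℝ × EuclideanSpace ℝ (Fin 3)) := WithLp.toLp 2 (1, 0)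
  obtain ⟨ψ, hψ⟩ := exists_linearIsometryEquiv_apply_eq (u := u) (v := q)
    (by simp [(WithLp.linearEquiv 2 ℝ (ℝ × EuclideanSpace ℝ (Fin 3))).finrank_eq])
    (by simp [u]) hq
  refine ⟨(MeasurableEquiv.toLp 2 (ℝ × EuclideanSpace ℝ (Fin 3))).trans ψ.toMeasurableEquiv,
    ψ.measurePreserving.comp (WithLp.volume_preserving_toLp _ _), fun p => ⟨?_, ?_⟩⟩
  · simp [WithLp.prod_norm_sq_eq_of_L2]
  · rw [← hψ]
    simp [u]

theorem integrable_sq_mul_abs_of_norm {f : ℝ → ℝ} :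
    Integrable (fun y : EuclideanSpace ℝ (Fin 3) => f ‖y‖) ↔
      Integrable (fun s : ℝ => s ^ 2 * f |s|) := by
  have h := integrable_fun_norm_addHaar (volume : Measure ℝ) (f := fun s => s ^ 2 * f s)
  simp only [Real.norm_eq_abs, sq_abs, Module.finrank_self] at h
  rw [h, integrable_fun_norm_addHaar]
  simp

theorem integral_fun_norm_fin_three (f : ℝ → ℝ) :
    ∫ y : EuclideanSpace ℝ (Fin 3), f ‖y‖ = 2 * π * ∫ s : ℝ, s ^ 2 * f |s| := by
  have h := integral_fun_norm_addHaar (volume : Measure ℝ) (fun s => s ^ 2 * f s)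
  simp only [Real.norm_eq_abs, sq_abs, Module.finrank_self] at h
  rw [h, integral_fun_norm_addHaar]
  have hv : (volume : Measure (EuclideanSpace ℝ (Fin 3))).real (Metric.ball 0 1) = π * (4 / 3) := by
    have hπ : 0 ≤ π * 4 / 3 := by have := pi_nonneg; positivity
    simp [Measure.real, ENNReal.toReal_ofReal hπ]
    ring
  simp [hv]
  ring

theorem integrable_and_integral_cylindrical {G : ℝ × ℝ → ℝ} (hG : Measurable G)
    (h : Integrable (fun p : ℝ × EuclideanSpace ℝ (Fin 3) => G (p.1, ‖p.2‖))) :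
    Integrable (fun p : ℝ × ℝ => p.2 ^ 2 * G (p.1, |p.2|)) ∧
    ∫ p : ℝ × EuclideanSpace ℝ (Fin 3), G (p.1, ‖p.2‖) =
      2 * π * ∫ p : ℝ × ℝ, p.2 ^ 2 * G (p.1, |p.2|) := by
  have h2 : Integrable (fun p : ℝ × ℝ => p.2 ^ 2 * G (p.1, |p.2|)) := by
    have hm : Measurable (fun p : ℝ × ℝ => p.2 ^ 2 * G (p.1, |p.2|)) := by fun_prop
    rw [Measure.volume_eq_prod, integrable_prod_iff hm.aestronglyMeasurable]
    rw [Measure.volume_eq_prod, integrable_prod_iff h.aestronglyMeasurable] at h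
    refine ⟨?_, ?_⟩
    · filter_upwards [h.1] with t ht
      exact (integrable_sq_mul_abs_of_norm (f := fun s => G (t, s))).1 ht
    · have := h.2
      have hn : ∀ t, ∫ y : EuclideanSpace ℝ (Fin 3), ‖G (t, ‖y‖)‖ =
          2 * π * ∫ s : ℝ, s ^ 2 * ‖G (t, |s|)‖ :=
        fun t => integral_fun_norm_fin_three fun s => ‖G (t, s)‖
      simp only [hn] at this
      simpa [integrable_const_mul_iff, pi_ne_zero] using this
  refine ⟨h2, ?_⟩
  rw [Measure.volume_eq_prod, integral_prod _ h, Measure.volume_eq_prod, integral_prod _ h2,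
    ← integral_const_mul]
  exact integral_congr_ae (.of_forall fun t => integral_fun_norm_fin_three fun s => G (t, s))

theorem integrableOn_comp_polarCoord_symm {f : ℝ × ℝ → ℝ} (hf : Integrable f) :
    IntegrableOn (fun p => p.1 * f (polarCoord.symm p)) polarCoord.target := by
  have h := (integrableOn_image_iff_integrableOn_abs_det_fderiv_smul volume
    polarCoord.open_target.measurableSet
    (fun p _ => (hasFDerivAt_polarCoord_symm p).hasFDerivWithinAt)
    polarCoord.symm.injOn f).1 hf.integrableOn
  refine h.congr_fun (fun p hp => ?_) polarCoord.open_target.measurableSet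
  simp [det_fderivPolarCoordSymm, abs_of_pos (show 0 < p.1 from hp.1)]

theorem integral_eq_integral_polar {f : ℝ × ℝ → ℝ} (hf : Integrable f) :
    ∫ p, f p = ∫ r in Set.Ioi (0 : ℝ), r * ∫ θ in (-π)..π, f (r * cos θ, r * sin θ) := by
  have h := integrableOn_comp_polarCoord_symm hf
  rw [← integral_comp_polarCoord_symm]
  simp only [polarCoord_target, Measure.volume_eq_prod] at h ⊢
  simp only [smul_eq_mul]
  rw [setIntegral_prod _ h]
  simp [intervalIntegral.integral_of_le (neg_le_self pi_nonneg), integral_Ioc_eq_integral_Ioo,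
    integral_const_mul]

theorem one_add_sq_add_two_mul_cos_pos {r : ℝ} (h0 : 0 < r) (h1 : r ≠ 1) (θ : ℝ) :
    0 < r ^ 2 + 2 * (r * cos θ) + 1 := by
  have : 0 < (r - 1) ^ 2 := by have := sub_ne_zero.2 h1; positivity
  nlinarith [neg_one_le_cos θ]

theorem angular_integral_of_lt_one {r : ℝ} (h0 : 0 < r) (h1 : r < 1) :
    ∫ θ in (-π)..π, sin θ ^ 2 * cos θ / (r ^ 2 + 2 * (r * cos θ) + 1) = -(π * r / 2) := by
  have hD := one_add_sq_add_two_mul_cos_pos h0 h1.ne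
  have hc : ∀ θ, 0 < 1 + r * cos θ := fun θ => by nlinarith [neg_one_le_cos θ]
  have hd : ∀ θ : ℝ, HasDerivAt (fun θ : ℝ =>
      ((1 / 2 - (1 + r ^ 2) ^ 2 / (4 * r ^ 2)) * θ + (1 + r ^ 2) / (2 * r) * sin θ
        - sin θ * cos θ / 2) / (2 * r)
      + (1 + r ^ 2) * (1 - r ^ 2) / (8 * r ^ 3)
        * (θ - 2 * arctan (r * sin θ / (1 + r * cos θ))))
      (sin θ ^ 2 * cos θ / (r ^ 2 + 2 * (r * cos θ) + 1)) θ := by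
    intro θ
    have hA := ((((hasDerivAt_sin θ).const_mul r).div
      (((hasDerivAt_cos θ).const_mul r).const_add 1) (hc θ).ne').arctan)
    have hA' : HasDerivAt (fun θ => arctan (r * sin θ / (1 + r * cos θ)))
        ((r ^ 2 + r * cos θ) / (r ^ 2 + 2 * (r * cos θ) + 1)) θ := by
      refine hA.congr_deriv ?_
      have h2 := hD θ
      have h3 := hc θ
      have h4 : (1 + r * cos θ) ^ 2 + (r * sin θ) ^ 2 = r ^ 2 + 2 * (r * cos θ) + 1 := by
        linear_combination r ^ 2 * sin_sq_add_cos_sq θ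
      have h5 : 1 + (r * sin θ / (1 + r * cos θ)) ^ 2 =
          (r ^ 2 + 2 * (r * cos θ) + 1) / (1 + r * cos θ) ^ 2 := by
        rw [← h4]; field_simp
      simp only [Pi.div_apply, h5]
      generalize r ^ 2 + 2 * (r * cos θ) + 1 = D at *
      field_simp
      linear_combination r * sin_sq_add_cos_sq θ
    have hB := (((((hasDerivAt_id θ).const_mul (1 / 2 - (1 + r ^ 2) ^ 2 / (4 * r ^ 2))).add
      ((hasDerivAt_sin θ).const_mul ((1 + r ^ 2) / (2 * r)))).sub
      (((hasDerivAt_sin θ).mul (hasDerivAt_cos θ)).div_const 2)).div_const (2 * r)).add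
      (((hasDerivAt_id θ).sub (hA'.const_mul 2)).const_mul
        ((1 + r ^ 2) * (1 - r ^ 2) / (8 * r ^ 3)))
    refine hB.congr_deriv ?_
    have h2 := (hD θ).ne'
    have hs := sin_sq θ
    generalize hcc : cos θ = c at *
    have hs' : sin θ * -sin θ = -(1 - c ^ 2) := by rw [← hs]; ring
    rw [hs, hs']
    clear hA hA' hB
    generalize hDe : r ^ 2 + 2 * (r * c) + 1 = D at *
    field_simp
    rw [← hDe]
    ring
  rw [intervalIntegral.integral_eq_sub_of_hasDerivAt (fun θ _ => hd θ)]
  · simp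
    field_simp
    ring
  · apply Continuous.intervalIntegrable
    exact Continuous.div (by fun_prop) (by fun_prop) fun θ => (hD θ).ne'

theorem angular_integral_of_one_lt {r : ℝ} (h1 : 1 < r) :
    ∫ θ in (-π)..π, sin θ ^ 2 * cos θ / (r ^ 2 + 2 * (r * cos θ) + 1) = -(π / (2 * r ^ 3)) := by
  have h0 : 0 < r := by positivity
  have h := angular_integral_of_lt_one (inv_pos.2 h0) (inv_lt_one_of_one_lt₀ h1)
  have : ∀ θ : ℝ, sin θ ^ 2 * cos θ / (r ^ 2 + 2 * (r * cos θ) + 1) =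
      (r ^ 2)⁻¹ * (sin θ ^ 2 * cos θ / (r⁻¹ ^ 2 + 2 * (r⁻¹ * cos θ) + 1)) := by
    intro θ
    have : r⁻¹ ^ 2 + 2 * (r⁻¹ * cos θ) + 1 = (r ^ 2 + 2 * (r * cos θ) + 1) / r ^ 2 := by
      field_simp
      ring
    rw [this]
    field_simp
  simp only [this]
  rw [intervalIntegral.integral_const_mul, h]
  field_simp

theorem integrableOn_ball_norm_rpow {s : ℝ} (hs : s < 4) (r : ℝ) :
    IntegrableOn (fun x : EuclideanSpace ℝ (Fin 4) => ‖x‖ ^ (-s)) (Metric.ball 0 r) := by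
  rcases le_or_gt r 0 with hr | hr
  · simp [Metric.ball_eq_empty.2 hr]
  rw [integrableOn_fun_norm_addHaar volume (f := fun y => y ^ (-s))]
  have h := intervalIntegral.intervalIntegrable_rpow' (a := 0) (b := r) (r := 3 - s) (by linarith)
  rw [intervalIntegrable_iff_integrableOn_Ioo_of_le hr.le] at h
  refine h.congr_fun (fun y hy => ?_) measurableSet_Ioo
  simp only [finrank_euclideanSpace, Fintype.card_fin, smul_eq_mul]
  rw [sub_eq_add_neg, rpow_add hy.1]
  norm_cast

theorem norm_inner_div_le {E : Type*} [NormedAddCommGroup E] [InnerProductSpace ℝ E] {q : E}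
    (hq : ‖q‖ = 1) (ρ : ℝ) (x : E) :
    ‖⟪x, q⟫ / ((‖x‖ ^ 2 : ℝ) ^ (1 + ρ) * ‖x + q‖ ^ 2)‖ ≤
      ‖x‖ ^ (-(1 + 2 * ρ)) * (‖x + q‖ ^ 2)⁻¹ := by
  rcases eq_or_ne x 0 with rfl | hx
  · simp only [inner_zero_left, zero_div, norm_zero]
    positivity
  have hx' : 0 < ‖x‖ := norm_pos_iff.2 hx
  have h1 : |⟪x, q⟫| ≤ ‖x‖ := by simpa [hq] using abs_real_inner_le_norm x q
  have h2 : ‖x‖ ^ (-(1 + 2 * ρ)) = ‖x‖ / (‖x‖ ^ 2 : ℝ) ^ (1 + ρ) := by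
    rw [← rpow_natCast, ← rpow_mul hx'.le, eq_div_iff (by positivity), ← rpow_add hx']
    norm_num
    ring_nf
    simp
  rw [h2, ← div_eq_mul_inv, div_div, norm_div, Real.norm_eq_abs, Real.norm_of_nonneg (by positivity)]
  gcongr

theorem integrable_inner_div {q : EuclideanSpace ℝ (Fin 4)} (hq : ‖q‖ = 1)
    {ρ : ℝ} (hρ1 : 1 / 2 < ρ) (hρ2 : ρ < 3 / 2) :
    Integrable (fun x : EuclideanSpace ℝ (Fin 4) =>
      ⟪x, q⟫ / ((‖x‖ ^ 2 : ℝ) ^ (1 + ρ) * ‖x + q‖ ^ 2)) := by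
  set s := 1 + 2 * ρ with hs
  have i1 : Integrable ((Metric.ball 0 (1 / 2)).indicator
      fun x : EuclideanSpace ℝ (Fin 4) => ‖x‖ ^ (-s)) :=
    (integrable_indicator_iff measurableSet_ball).2
      (integrableOn_ball_norm_rpow (by linarith) _)
  have i2 : Integrable ((Metric.ball 0 1).indicator
      fun x : EuclideanSpace ℝ (Fin 4) => ‖x‖ ^ (-2 : ℝ)) :=
    (integrable_indicator_iff measurableSet_ball).2
      (integrableOn_ball_norm_rpow (by norm_num) _)
  have i3 : Integrable fun x : EuclideanSpace ℝ (Fin 4) => (1 + ‖x‖) ^ (-(s + 2)) :=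
    integrable_one_add_norm (by simp; linarith)
  have i := ((i1.const_mul 4).add ((i2.comp_add_right q).const_mul (2 ^ s))).add
    ((i3.comp_add_right q).const_mul (4 * 5 ^ s))
  refine i.mono' (Measurable.aestronglyMeasurable (by fun_prop)) (.of_forall fun x => ?_)
  refine (norm_inner_div_le hq ρ x).trans ?_
  have hs0 : 0 ≤ s := by linarith
  have hab : 1 ≤ ‖x‖ + ‖x + q‖ := by
    have := norm_sub_le (x + q) x
    rw [add_sub_cancel_left, hq] at this
    linarith
  have hba : ‖x + q‖ ≤ ‖x‖ + 1 := hq ▸ norm_add_le x q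
  have p1 : 0 ≤ (Metric.ball 0 (1 / 2)).indicator
      (fun x : EuclideanSpace ℝ (Fin 4) => ‖x‖ ^ (-s)) x :=
    Set.indicator_nonneg (fun _ _ => by positivity) _
  have p2 : 0 ≤ (Metric.ball 0 1).indicator
      (fun x : EuclideanSpace ℝ (Fin 4) => ‖x‖ ^ (-2 : ℝ)) (x + q) :=
    Set.indicator_nonneg (fun _ _ => by positivity) _
  have p3 : 0 ≤ (1 + ‖x + q‖) ^ (-(s + 2)) := by positivity
  simp only [Pi.add_apply]
  rcases lt_or_ge ‖x‖ (1 / 2) with ha | ha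
  · have hb : 1 / 2 ≤ ‖x + q‖ := by linarith
    rw [Set.indicator_of_mem (by simpa using ha)] at p1 ⊢
    have : (‖x + q‖ ^ 2)⁻¹ ≤ 4 := by
      rw [inv_le_comm₀ (by positivity) (by norm_num)]
      nlinarith
    have := mul_le_mul_of_nonneg_left this p1
    have : 0 ≤ (2 : ℝ) ^ s := by positivity
    have : 0 ≤ (5 : ℝ) ^ s := by positivity
    nlinarith [mul_nonneg this p3, mul_nonneg ‹0 ≤ (2 : ℝ) ^ s› p2]
  have hpow : ∀ {c : ℝ}, 0 < c → ∀ {y : ℝ}, 0 < y → y ≤ c * ‖x‖ →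
      ‖x‖ ^ (-s) ≤ c ^ s * y ^ (-s) := by
    intro c hc y hy h
    have h' := rpow_le_rpow_of_nonpos hy h (neg_nonpos.2 hs0)
    rw [mul_rpow hc.le (norm_nonneg _)] at h'
    calc ‖x‖ ^ (-s) = c ^ s * (c ^ (-s) * ‖x‖ ^ (-s)) := by
          rw [← mul_assoc, ← rpow_add hc]; simp
      _ ≤ _ := by gcongr
  rcases lt_or_ge ‖x + q‖ 1 with hb | hb
  · rw [Set.indicator_of_mem (s := Metric.ball 0 1) (by simpa using hb)]
    have h1 := hpow (c := 2) two_pos one_pos (by linarith)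
    have h2 : ‖x + q‖ ^ (-2 : ℝ) = (‖x + q‖ ^ 2)⁻¹ := by
      rw [rpow_neg (norm_nonneg _), rpow_two]
    rw [one_rpow, mul_one] at h1
    rw [h2]
    have h3 := mul_le_mul_of_nonneg_right h1 (show 0 ≤ (‖x + q‖ ^ 2)⁻¹ by positivity)
    have : 0 ≤ 4 * (5 : ℝ) ^ s * (1 + ‖x + q‖) ^ (-(s + 2)) := by positivity
    linarith
  · have h1 := hpow (c := 5) (by norm_num) (y := 1 + ‖x + q‖) (by positivity) (by linarith)
    have h2 : (‖x + q‖ ^ 2)⁻¹ ≤ 4 * ((1 + ‖x + q‖) ^ 2)⁻¹ := by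
      rw [← div_eq_mul_inv, le_div_iff₀ (by positivity), inv_mul_le_iff₀ (by positivity)]
      nlinarith
    have h3 : (1 + ‖x + q‖) ^ (-(s + 2)) = (1 + ‖x + q‖) ^ (-s) * ((1 + ‖x + q‖) ^ 2)⁻¹ := by
      rw [neg_add, rpow_add (by positivity), rpow_neg (y := 2) (by positivity), rpow_two]
    rw [h3]
    have h4 := mul_le_mul h1 h2 (by positivity) (by positivity)
    have : 0 ≤ (2 : ℝ) ^ s := by positivity
    nlinarith [mul_nonneg this p2]

theorem radial_integral {ρ : ℝ} (h0 : 0 < ρ) (h2 : ρ < 2) {f : ℝ → ℝ}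
    (hf1 : ∀ r, 0 < r → r < 1 → f r = r ^ (3 - 2 * ρ))
    (hf2 : ∀ r, 1 < r → f r = r ^ (-1 - 2 * ρ)) :
    ∫ r in Set.Ioi (0 : ℝ), f r = -1 / (ρ * (ρ - 2)) := by
  have hI := integrableOn_Ioi_rpow_of_lt (a := -1 - 2 * ρ) (by linarith) one_pos
  have hJ := intervalIntegral.intervalIntegrable_rpow' (a := 0) (b := 1) (r := 3 - 2 * ρ)
    (by linarith)
  rw [intervalIntegrable_iff_integrableOn_Ioo_of_le zero_le_one] at hJ
  have e1 : Set.EqOn f (fun r => r ^ (3 - 2 * ρ)) (Set.Ioo 0 1) := fun r hr => hf1 r hr.1 hr.2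
  have e2 : Set.EqOn f (fun r => r ^ (-1 - 2 * ρ)) (Set.Ioi 1) := fun r hr => hf2 r hr
  rw [← Set.Ioc_union_Ioi_eq_Ioi zero_le_one, setIntegral_union (Set.Ioc_disjoint_Ioi le_rfl)
    measurableSet_Ioi
    (integrableOn_Ioc_iff_integrableOn_Ioo (by simp) |>.2 (hJ.congr_fun e1.symm measurableSet_Ioo))
    (hI.congr_fun e2.symm measurableSet_Ioi), integral_Ioc_eq_integral_Ioo,
    setIntegral_congr_fun measurableSet_Ioo e1, setIntegral_congr_fun measurableSet_Ioi e2,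
    integral_Ioi_rpow_of_lt (by linarith) one_pos, ← integral_Ioc_eq_integral_Ioo,
    ← intervalIntegral.integral_of_le zero_le_one, integral_rpow (.inl (by linarith)), one_rpow,
    one_rpow, zero_rpow (by linarith)]
  have : ρ - 2 ≠ 0 := by linarith
  have : 3 - 2 * ρ + 1 ≠ 0 := by linarith
  have : -1 - 2 * ρ + 1 ≠ 0 := by linarith
  field_simp
  ring

theorem rpow_radial_factor {r : ℝ} (hr : 0 < r) (ρ : ℝ) :
    r ^ 4 / (r ^ 2 : ℝ) ^ (1 + ρ) = r ^ (2 - 2 * ρ) := by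
  rw [← rpow_natCast r 2, ← rpow_mul hr.le, ← rpow_natCast r 4, ← rpow_sub hr]
  congr 1
  push_cast
  ring

/-- The Mellin transform of the one-loop massless Yukawa fermion
self-energy: for `‖q‖ = 1` and `1/2 < ρ < 3/2`, the function
`k ↦ ⟨k,q⟩ / ((‖k‖²)^(1+ρ) ‖k+q‖²)` is integrable on `ℝ⁴` and its integral equals
`π² / (ρ(ρ−2))`. -/
theorem yukawa_one_loop_mellin (q : EuclideanSpace ℝ (Fin 4)) (hq : ‖q‖ = 1)
    (ρ : ℝ) (hρ1 : 1 / 2 < ρ) (hρ2 : ρ < 3 / 2) :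
    Integrable (fun x : EuclideanSpace ℝ (Fin 4) =>
        ⟪x, q⟫ / ((‖x‖ ^ 2 : ℝ) ^ (1 + ρ) * ‖x + q‖ ^ 2)) ∧
    ∫ x : EuclideanSpace ℝ (Fin 4),
        ⟪x, q⟫ / ((‖x‖ ^ 2 : ℝ) ^ (1 + ρ) * ‖x + q‖ ^ 2) =
      π ^ 2 / (ρ * (ρ - 2)) := by
  have hint := integrable_inner_div hq hρ1 hρ2
  refine ⟨hint, ?_⟩
  obtain ⟨φ, hφ, hφq⟩ := exists_measurePreserving_axial q hq
  let G : ℝ × ℝ → ℝ := fun p =>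
    p.1 / ((p.1 ^ 2 + p.2 ^ 2) ^ (1 + ρ) * (p.1 ^ 2 + p.2 ^ 2 + 2 * p.1 + 1))
  have hφG : ∀ p, ⟪φ p, q⟫ / ((‖φ p‖ ^ 2 : ℝ) ^ (1 + ρ) * ‖φ p + q‖ ^ 2) = G (p.1, ‖p.2‖) := by
    intro p
    simp only [G, norm_add_sq_real, hφq, hq, one_pow]
  have hG : Measurable G := by fun_prop
  rw [← hφ.integrable_comp_emb φ.measurableEmbedding] at hint
  simp only [Function.comp_def, hφG] at hint
  rw [← hφ.integral_comp φ.measurableEmbedding]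
  simp only [hφG]
  obtain ⟨hint2, hcyl⟩ := integrable_and_integral_cylindrical hG hint
  have hang : ∀ r θ : ℝ, 0 < r → r * ((r * sin θ) ^ 2 * G (r * cos θ, |r * sin θ|)) =
      r ^ (2 - 2 * ρ) * (sin θ ^ 2 * cos θ / (r ^ 2 + 2 * (r * cos θ) + 1)) := by
    intro r θ hr
    have hrθ : (r * cos θ) ^ 2 + (r * sin θ) ^ 2 = r ^ 2 := by
      linear_combination r ^ 2 * sin_sq_add_cos_sq θ
    simp only [G, sq_abs, hrθ, ← rpow_radial_factor hr]
    rw [div_mul_div_comm, ← mul_assoc, mul_div_assoc', ← mul_assoc 2 r]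
    ring
  rw [hcyl, integral_eq_integral_polar hint2]
  simp only [← intervalIntegral.integral_const_mul]
  rw [setIntegral_congr_fun measurableSet_Ioi fun r hr =>
    intervalIntegral.integral_congr fun θ _ => hang r θ hr]
  simp only [intervalIntegral.integral_const_mul]
  have hrad := radial_integral (ρ := ρ) (by linarith) (by linarith)
    (f := fun r => -(2 / π) * (r ^ (2 - 2 * ρ) *
      ∫ θ in (-π)..π, sin θ ^ 2 * cos θ / (r ^ 2 + 2 * (r * cos θ) + 1)))
    (fun r h0 h1 => by
      rw [angular_integral_of_lt_one h0 h1, show 3 - 2 * ρ = (2 - 2 * ρ) + 1 by ring,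
        rpow_add h0, rpow_one]
      field_simp)
    (fun r h1 => by
      have h0 : 0 < r := by linarith
      rw [angular_integral_of_one_lt h1, show -1 - 2 * ρ = (2 - 2 * ρ) - (3 : ℕ) by push_cast; ring,
        rpow_sub_natCast h0.ne']
      field_simp)
  rw [integral_const_mul] at hrad
  have hπ : π ^ 2 * π⁻¹ = π := by field_simp
  generalize (∫ r in Set.Ioi (0 : ℝ), r ^ (2 - 2 * ρ) *
    ∫ θ in (-π)..π, sin θ ^ 2 * cos θ / (r ^ 2 + 2 * (r * cos θ) + 1)) = I at *
  linear_combination (-π ^ 2) * hrad - 2 * I * hπ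
end

section
/- Let G : ℝ × ℝ → ℝ be a smooth (C^∞) function of (α, L) with G(α,0) = 1 for all α, let β : ℝ → ℝ be smooth, and define the Taylor coefficients γ_k(α) := (1/k!)·(∂^k G/∂L^k)(α,0) for k ≥ 1, so that γ_1(α) = (∂G/∂L)(α,0). Suppose G satisfies the renormalization group equation (∂G/∂L)(α,L) = γ_1(α)·G(α,L) + α·β(α)·(∂G/∂α)(α,L) for all (α,L). Then for every k ≥ 2 and every α, γ_k(α) = (1/k)·[ γ_1(α)·γ_{k−1}(α) + α·β(α)·γ'_{k−1}(α) ], where γ'_{k−1} denotes the derivative of γ_{k−1} with respect to α. -/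
lemma deriv_comp_prodMk_right {F : ℝ × ℝ → ℝ} {p : ℝ × ℝ} (hF : DifferentiableAt ℝ F p) :
    deriv (fun y => F (p.1, y)) p.2 = fderiv ℝ F p (0, 1) :=
  (HasFDerivAt.comp_hasDerivAt p.2 hF.hasFDerivAt
    ((hasDerivAt_const p.2 p.1).prodMk (hasDerivAt_id p.2))).deriv

lemma deriv_comp_prodMk_left {F : ℝ × ℝ → ℝ} {p : ℝ × ℝ} (hF : DifferentiableAt ℝ F p) :
    deriv (fun x => F (x, p.2)) p.1 = fderiv ℝ F p (1, 0) :=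
  (HasFDerivAt.comp_hasDerivAt p.1 hF.hasFDerivAt
    ((hasDerivAt_id p.1).prodMk (hasDerivAt_const p.1 p.2))).deriv

lemma contDiff_fderiv_apply_const {F : ℝ × ℝ → ℝ} (hF : ContDiff ℝ (⊤ : ℕ∞) F) (v : ℝ × ℝ) :
    ContDiff ℝ (⊤ : ℕ∞) (fun p => fderiv ℝ F p v) :=
  (hF.fderiv_right (m := (⊤ : ℕ∞)) (by simp)).clm_apply contDiff_const

/-- Mixed directional derivatives of a smooth function commute. -/
lemma fderiv_fderiv_apply_comm {F : ℝ × ℝ → ℝ} (hF : ContDiff ℝ (⊤ : ℕ∞) F) (p v w : ℝ × ℝ) :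
    fderiv ℝ (fun q => fderiv ℝ F q v) p w = fderiv ℝ (fun q => fderiv ℝ F q w) p v := by
  have hd : DifferentiableAt ℝ (fderiv ℝ F) p :=
    (hF.fderiv_right (m := (⊤ : ℕ∞)) (by simp)).differentiable (by simp) p
  have hs : IsSymmSndFDerivAt ℝ F p :=
    hF.contDiffAt.isSymmSndFDerivAt (by
      rw [minSmoothness_of_isRCLikeNormedField]
      exact WithTop.coe_le_coe.2 (le_top : (2 : ℕ∞) ≤ ⊤))
  have key (u : ℝ × ℝ) : fderiv ℝ (fun q => fderiv ℝ F q u) p =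
      (fderiv ℝ (fderiv ℝ F) p).flip u := by
    rw [fderiv_clm_apply hd (differentiableAt_const u)]
    simp
  rw [key, key]
  exact hs.eq w v

/-- Iterated derivatives in the second variable commute with the derivative in the first. -/
lemma iteratedDeriv_deriv_comm (n : ℕ) {F : ℝ × ℝ → ℝ} (hF : ContDiff ℝ (⊤ : ℕ∞) F) (x y : ℝ) :
    iteratedDeriv n (fun y' => deriv (fun x' => F (x', y')) x) y =
      deriv (fun x' => iteratedDeriv n (fun y' => F (x', y')) y) x := by
  induction n generalizing F with
  | zero => simp
  | succ n ih =>
    have hdF : Differentiable ℝ F := hF.differentiable (by simp)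
    have hF₁ := contDiff_fderiv_apply_const hF (1, 0)
    have hF₂ := contDiff_fderiv_apply_const hF (0, 1)
    have hright (x' : ℝ) :
        deriv (fun y' => F (x', y')) = fun y' => fderiv ℝ F (x', y') (0, 1) :=
      funext fun y' => deriv_comp_prodMk_right (hdF (x', y'))
    have hleft : (fun y' => deriv (fun x' => F (x', y')) x) =
        fun y' => fderiv ℝ F (x, y') (1, 0) :=
      funext fun y' => deriv_comp_prodMk_left (hdF (x, y'))
    have hmixed : deriv (fun y' => fderiv ℝ F (x, y') (1, 0)) =
        fun y' => deriv (fun x' => fderiv ℝ F (x', y') (0, 1)) x := by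
      funext y'
      rw [deriv_comp_prodMk_right (p := (x, y')) (hF₁.differentiable (by simp) _),
        deriv_comp_prodMk_left (p := (x, y')) (hF₂.differentiable (by simp) _),
        fderiv_fderiv_apply_comm hF]
    simp only [iteratedDeriv_succ', hright, hleft, hmixed]
    exact ih hF₂


/-- The renormalization group recursion: if a smooth single-scale
Green function `G(α,L)` with `G(α,0) = 1` satisfies the renormalization group
equation `∂_L G = γ₁(α)·G + α·β(α)·∂_α G`, then its Taylor coefficients
`γ_k(α) = (1/k!)·∂_L^k G(α,0)` satisfy, for `k ≥ 2`,
`γ_k = (1/k)[γ₁·γ_{k−1} + α·β·γ'_{k−1}]`. -/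
theorem rg_recursion_for_log_coefficients (G : ℝ × ℝ → ℝ) (β : ℝ → ℝ)
    (hG : ContDiff ℝ (⊤ : ℕ∞) G) (hβ : ContDiff ℝ (⊤ : ℕ∞) β)
    (hG0 : ∀ α : ℝ, G (α, 0) = 1)
    (γ : ℕ → ℝ → ℝ)
    (hγ : ∀ (k : ℕ) (α : ℝ),
      γ k α = (1 / (Nat.factorial k : ℝ)) * iteratedDeriv k (fun L => G (α, L)) 0)
    (hRGE : ∀ α L : ℝ, deriv (fun L' => G (α, L')) L =
      γ 1 α * G (α, L) + α * β α * deriv (fun a => G (a, L)) α) :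
    ∀ k : ℕ, 2 ≤ k → ∀ α : ℝ,
      γ k α = (1 / (k : ℝ)) *
        (γ 1 α * γ (k - 1) α + α * β α * deriv (fun a => γ (k - 1) a) α) := by
  intro k hk α
  obtain ⟨n, rfl⟩ : ∃ n, k = n + 1 := ⟨k - 1, by omega⟩
  have hslice : ContDiff ℝ (⊤ : ℕ∞) (fun L => G (α, L)) :=
    hG.comp (contDiff_const.prodMk contDiff_id)
  have hpartial : ContDiff ℝ (⊤ : ℕ∞) (fun L => deriv (fun a => G (a, L)) α) := by
    have hleft : (fun L => deriv (fun a => G (a, L)) α) =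
        fun L => fderiv ℝ G (α, L) (1, 0) :=
      funext fun L => deriv_comp_prodMk_left (p := (α, L)) (hG.differentiable (by simp) _)
    rw [hleft]
    exact (contDiff_fderiv_apply_const hG (1, 0)).comp (contDiff_const.prodMk contDiff_id)
  have hn : ContDiff ℝ n (fun L => G (α, L)) := hslice.of_le (by exact_mod_cast le_top)
  have hn' : ContDiff ℝ n (fun L => deriv (fun a => G (a, L)) α) :=
    hpartial.of_le (by exact_mod_cast le_top)
  have hstep : iteratedDeriv (n + 1) (fun L => G (α, L)) 0 =
      γ 1 α * iteratedDeriv n (fun L => G (α, L)) 0 +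
        α * β α * deriv (fun a => iteratedDeriv n (fun L => G (a, L)) 0) α := by
    rw [iteratedDeriv_succ', funext (hRGE α),
      iteratedDeriv_fun_add (contDiff_const.mul hn).contDiffAt
        (contDiff_const.mul hn').contDiffAt,
      iteratedDeriv_const_mul_field, iteratedDeriv_const_mul_field,
      iteratedDeriv_deriv_comm n hG]
  have hderiv : deriv (fun a => γ n a) α = (1 / (n.factorial : ℝ)) *
      deriv (fun a => iteratedDeriv n (fun L => G (a, L)) 0) α := by
    rw [funext (hγ n), deriv_const_mul_field]
  rw [Nat.add_sub_cancel, hderiv, hγ (n + 1), hstep, hγ n, Nat.factorial_succ]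
  have hfact : (n.factorial : ℝ) ≠ 0 := by positivity
  have hsucc : ((n : ℝ) + 1) ≠ 0 := by positivity
  push_cast
  field_simp
end

section
/- Let u : ℝ × ℝ → ℝ be a smooth (C^∞) function of (a, L) with u(a,0) = 0 for all a, define γ_k(a) := (1/k!)·(∂^k u/∂L^k)(a,0) for k ≥ 1, and set γ_1(a) = (∂u/∂L)(a,0). Suppose u satisfies (∂u/∂L)(a,L) = γ_1(a)·[ 1 + u(a,L) − 2a·(∂u/∂a)(a,L) ] for all (a,L). Then for every k ≥ 2 and every a, γ_k(a) = (1/k)·γ_1(a)·( γ_{k−1}(a) − 2a·γ'_{k−1}(a) ), i.e. γ_k = (1/k)·γ_1·(1 − 2a∂_a)γ_{k−1}. -/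
/-- The directional derivative of `f` along the constant vector field `v`. -/
noncomputable def dirDeriv (v : ℝ × ℝ) (f : ℝ × ℝ → ℝ) (p : ℝ × ℝ) : ℝ :=
  fderiv ℝ f p v

lemma contDiff_dirDeriv {f : ℝ × ℝ → ℝ} (hf : ContDiff ℝ (⊤ : ℕ∞) f) (v : ℝ × ℝ) :
    ContDiff ℝ (⊤ : ℕ∞) (dirDeriv v f) :=
  (hf.fderiv_right (m := (⊤ : ℕ∞)) (by simp)).clm_apply contDiff_const

lemma contDiff_iterate_dirDeriv {f : ℝ × ℝ → ℝ} (hf : ContDiff ℝ (⊤ : ℕ∞) f) (v : ℝ × ℝ)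
    (n : ℕ) : ContDiff ℝ (⊤ : ℕ∞) ((dirDeriv v)^[n] f) := by
  induction n with
  | zero => exact hf
  | succ n ih =>
    rw [Function.iterate_succ_apply']
    exact contDiff_dirDeriv ih v

lemma dirDeriv_comm {f : ℝ × ℝ → ℝ} (hf : ContDiff ℝ (⊤ : ℕ∞) f) (v w p : ℝ × ℝ) :
    dirDeriv v (dirDeriv w f) p = dirDeriv w (dirDeriv v f) p := by
  have hd : DifferentiableAt ℝ (fderiv ℝ f) p :=
    (hf.fderiv_right (m := (⊤ : ℕ∞)) (by simp)).differentiable (by simp) p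
  have key : ∀ x y : ℝ × ℝ, dirDeriv x (dirDeriv y f) p = fderiv ℝ (fderiv ℝ f) p x y := by
    intro x y
    have h := hd.hasFDerivAt.clm_apply (hasFDerivAt_const y p)
    change fderiv ℝ (fun q => fderiv ℝ f q y) p x = _
    rw [h.fderiv]
    simp
  rw [key, key]
  exact (hf.contDiffAt.isSymmSndFDerivAt (by
    simpa using WithTop.coe_le_coe.2 (le_top : (2 : ℕ∞) ≤ ⊤))) v w

lemma hasDerivAt_slice_snd {f : ℝ × ℝ → ℝ} (hf : ContDiff ℝ (⊤ : ℕ∞) f) (a L : ℝ) :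
    HasDerivAt (fun L' => f (a, L')) (dirDeriv (0, 1) f (a, L)) L :=
  (hf.differentiable (by simp) (a, L)).hasFDerivAt.comp_hasDerivAt L
    ((hasDerivAt_const L a).prodMk (hasDerivAt_id L))

lemma hasDerivAt_slice_fst {f : ℝ × ℝ → ℝ} (hf : ContDiff ℝ (⊤ : ℕ∞) f) (a L : ℝ) :
    HasDerivAt (fun a' => f (a', L)) (dirDeriv (1, 0) f (a, L)) a :=
  (hf.differentiable (by simp) (a, L)).hasFDerivAt.comp_hasDerivAt a
    ((hasDerivAt_id a).prodMk (hasDerivAt_const a L))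

lemma iteratedDeriv_slice_snd {f : ℝ × ℝ → ℝ} (hf : ContDiff ℝ (⊤ : ℕ∞) f) (n : ℕ) (a : ℝ) :
    iteratedDeriv n (fun L => f (a, L)) = fun L => (dirDeriv (0, 1))^[n] f (a, L) := by
  induction n with
  | zero => simp
  | succ n ih =>
    funext L
    rw [iteratedDeriv_succ, ih, Function.iterate_succ_apply']
    exact (hasDerivAt_slice_snd (contDiff_iterate_dirDeriv hf _ n) a L).deriv

/-- Differentiating the renormalization group equation in its second variable. -/
lemma dirDeriv_snd_of_eq {f g : ℝ × ℝ → ℝ} (hf : ContDiff ℝ (⊤ : ℕ∞) f)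
    (hg : ContDiff ℝ (⊤ : ℕ∞) g) (c : ℝ → ℝ) (r : ℝ)
    (h : ∀ a L : ℝ, g (a, L) = c a * (r + f (a, L) - 2 * a * dirDeriv (1, 0) f (a, L)))
    (a L : ℝ) :
    dirDeriv (0, 1) g (a, L) = c a * (dirDeriv (0, 1) f (a, L) -
      2 * a * dirDeriv (1, 0) (dirDeriv (0, 1) f) (a, L)) := by
  have h₁ := hasDerivAt_slice_snd hg a L
  simp only [h] at h₁
  have h₂ := (((hasDerivAt_slice_snd hf a L).const_add r).sub
    ((hasDerivAt_slice_snd (contDiff_dirDeriv hf (1, 0)) a L).const_mul (2 * a))).const_mul (c a)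
  rw [dirDeriv_comm hf (1, 0) (0, 1)]
  exact h₁.unique h₂

lemma iterate_dirDeriv_snd_succ {u : ℝ × ℝ → ℝ} (hu : ContDiff ℝ (⊤ : ℕ∞) u) (c : ℝ → ℝ) (r : ℝ)
    (h : ∀ a L : ℝ, dirDeriv (0, 1) u (a, L) =
      c a * (r + u (a, L) - 2 * a * dirDeriv (1, 0) u (a, L))) (n : ℕ) (a L : ℝ) :
    (dirDeriv (0, 1))^[n + 2] u (a, L) = c a * ((dirDeriv (0, 1))^[n + 1] u (a, L) -
      2 * a * dirDeriv (1, 0) ((dirDeriv (0, 1))^[n + 1] u) (a, L)) := by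
  induction n generalizing a L with
  | zero => exact dirDeriv_snd_of_eq hu (contDiff_dirDeriv hu _) c r h a L
  | succ n ih =>
    have h₁ := dirDeriv_snd_of_eq (contDiff_iterate_dirDeriv hu _ (n + 1))
      (contDiff_iterate_dirDeriv hu _ (n + 2)) c 0 (fun a L => by rw [zero_add, ih]) a L
    simpa only [← Function.iterate_succ_apply' (dirDeriv (0, 1))] using h₁

/-- (Theorem 3 of the paper / Proposition 2 of Broadhurst–Kreimer.)
For the massless Yukawa propagator, if the smooth self-energy `u(a,L)` with
`u(a,0) = 0` satisfies `∂_L u = γ₁(a)·[1 + u − 2a·∂_a u]`, then the log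
coefficients `γ_k(a) = (1/k!)·∂_L^k u(a,0)` satisfy, for `k ≥ 2`,
`γ_k = (1/k)·γ₁·(1 − 2a∂_a)γ_{k−1}`. -/
theorem yukawa_next_to_leading_log_recursion (u : ℝ × ℝ → ℝ)
    (hu : ContDiff ℝ (⊤ : ℕ∞) u) (hu0 : ∀ a : ℝ, u (a, 0) = 0)
    (γ : ℕ → ℝ → ℝ)
    (hγ : ∀ (k : ℕ) (a : ℝ),
      γ k a = (1 / (Nat.factorial k : ℝ)) * iteratedDeriv k (fun L => u (a, L)) 0)
    (hPDE : ∀ a L : ℝ, deriv (fun L' => u (a, L')) L =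
      γ 1 a * (1 + u (a, L) - 2 * a * deriv (fun a' => u (a', L)) a)) :
    ∀ k : ℕ, 2 ≤ k → ∀ a : ℝ,
      γ k a = (1 / (k : ℝ)) * γ 1 a *
        (γ (k - 1) a - 2 * a * deriv (fun a' => γ (k - 1) a') a) := by
  intro k hk a
  obtain ⟨n, rfl⟩ := Nat.exists_eq_add_of_le' hk
  have hγ' : ∀ (k : ℕ) (a : ℝ),
      γ k a = (1 / (Nat.factorial k : ℝ)) * (dirDeriv (0, 1))^[k] u (a, 0) := by
    intro k a
    rw [hγ, iteratedDeriv_slice_snd hu]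
  have hd : deriv (fun a' => γ (n + 1) a') a = (1 / (Nat.factorial (n + 1) : ℝ)) *
      dirDeriv (1, 0) ((dirDeriv (0, 1))^[n + 1] u) (a, 0) := by
    simp only [hγ' (n + 1)]
    exact ((hasDerivAt_slice_fst (contDiff_iterate_dirDeriv hu _ (n + 1)) a 0).const_mul _).deriv
  have hrec := iterate_dirDeriv_snd_succ hu (γ 1) 1 (fun a L => by
    rw [← (hasDerivAt_slice_snd hu a L).deriv, ← (hasDerivAt_slice_fst hu a L).deriv, hPDE]) n a 0
  rw [show n + 2 - 1 = n + 1 from rfl, hd, hγ' (n + 2), hγ' (n + 1), hrec,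
    Nat.factorial_succ (n + 1)]
  have hfac : (Nat.factorial (n + 1) : ℝ) ≠ 0 := by positivity
  have hn : ((n + 2 : ℕ) : ℝ) ≠ 0 := by positivity
  push_cast at hn ⊢
  field_simp
  ring
end
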